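/- Let a(𝐳), b(𝐳) be local homogeneous End(E)-valued distributions. Then the pair (∂_z, ∂_z̄) is a translation endomorphism and a translation generator for the products: for all 𝐧=(n,n̄)∈K², (∂_z a(𝐳))_(𝐧)b(𝐳) = −n·a(𝐳)_((n−1,n̄))b(𝐳) and (∂_z̄ a(𝐳))_(𝐧)b(𝐳) = −n̄·a(𝐳)_((n,n̄−1))b(𝐳), and moreover ∂_z(a(𝐳)_(𝐧)b(𝐳)) = (∂_z a(𝐳))_(𝐧)b(𝐳) + a(𝐳)_(𝐧)(∂_z b(𝐳)) and ∂_z̄(a(𝐳)_(𝐧)b(𝐳)) = (∂_z̄ a(𝐳))_(𝐧)b(𝐳) + a(𝐳)_(𝐧)(∂_z̄ b(𝐳)). (Here the pairs ∂_z a(𝐳), b(𝐳) and a(𝐳), ∂_z b(𝐳), etc., are again local, via the differentiated OPEs.) -/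

import Mathlib

open scoped BigOperators Classical

noncomputable section

namespace OPEA

variable (K : Type*) [Field K] [CharZero K]

/-- index pairs 𝐧 = (n, n̄) ∈ K² -/
abbrev Idx := K × K

def IsInt (x : K) : Prop := ∃ k : ℤ, (k : K) = x

def IsNegInt (x : K) : Prop := ∃ k : ℤ, k < 0 ∧ (k : K) = x

/-- 𝕂̄ = {𝐧 ∈ K² | n − n̄ ∈ ℤ} -/
def Kbar (n : Idx K) : Prop := IsInt K (n.1 - n.2)

def IsIntPair (n : Idx K) : Prop := IsInt K n.1 ∧ IsInt K n.2

/-- generalized binomial coefficient C(x,k) -/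
def gchoose (x : K) (k : ℕ) : K :=
  (∏ i ∈ Finset.range k, (x - (i : K))) / (k.factorial : K)

/-- (−1)^x for x an integer image in K (and 1 otherwise) -/
def negOnePow (x : K) : K :=
  if h : ∃ k : ℤ, (k : K) = x then (-1 : K) ^ h.choose else 1

variable (M : Type*) [AddCommGroup M] [Module K M]

/-- M-valued distribution in one variable pair -/
abbrev Dist1 := Idx K → M

/-- M-valued distribution in two variable pairs -/
abbrev Dist2 := Idx K → Idx K → M

/-- M-valued distribution in r variable pairs -/
abbrev DistN (r : ℕ) := (Fin r → Idx K) → M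

/-- membership in M[[𝐳]] -/
def IsPow1 (a : Dist1 K M) : Prop := ∀ n, a n ≠ 0 → IsNegInt K n.1 ∧ IsNegInt K n.2

/-- membership in M⌊𝐳⌋ -/
def InLat1 (a : Dist1 K M) : Prop :=
  ∃ S : Finset (Idx K), ∀ n, a n ≠ 0 →
    ∃ m ∈ S, IsNegInt K (n.1 - m.1) ∧ IsNegInt K (n.2 - m.2)

/-- membership in M[[𝐳,𝐰]] -/
def IsPow2 (a : Dist2 K M) : Prop :=
  ∀ n k, a n k ≠ 0 →
    (IsNegInt K n.1 ∧ IsNegInt K n.2) ∧ (IsNegInt K k.1 ∧ IsNegInt K k.2)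

/-- membership in M⌊𝐳,𝐰⌋ -/
def InLat2 (a : Dist2 K M) : Prop :=
  ∃ S : Finset (Idx K × Idx K), ∀ n k, a n k ≠ 0 →
    ∃ m ∈ S, (IsNegInt K (n.1 - m.1.1) ∧ IsNegInt K (n.2 - m.1.2)) ∧
      (IsNegInt K (k.1 - m.2.1) ∧ IsNegInt K (k.2 - m.2.2))

/-- membership in M[[𝐳₁,…,𝐳ᵣ]] -/
def IsPowN {r : ℕ} (a : DistN K M r) : Prop :=
  ∀ n, a n ≠ 0 → ∀ i, IsNegInt K (n i).1 ∧ IsNegInt K (n i).2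

/-- membership in M⌊𝐳₁,…,𝐳ᵣ⌋ -/
def InLatN {r : ℕ} (a : DistN K M r) : Prop :=
  ∃ S : Finset (Fin r → Idx K), ∀ n, a n ≠ 0 →
    ∃ m ∈ S, ∀ i, IsNegInt K ((n i).1 - (m i).1) ∧ IsNegInt K ((n i).2 - (m i).2)

/-- ∂_z -/
def dz (a : Dist1 K M) : Dist1 K M := fun n => (-n.1) • a (n.1 - 1, n.2)

/-- ∂_z̄ -/
def dzb (a : Dist1 K M) : Dist1 K M := fun n => (-n.2) • a (n.1, n.2 - 1)

/-- ∂ in the first variable pair of a two-variable distribution (z-component) -/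
def d1z (c : Dist2 K M) : Dist2 K M := fun n k => (-n.1) • c (n.1 - 1, n.2) k

/-- ∂ in the first variable pair of a two-variable distribution (z̄-component) -/
def d1zb (c : Dist2 K M) : Dist2 K M := fun n k => (-n.2) • c (n.1, n.2 - 1) k

/-- divided power d^{(x)} of an operator d, for a K-valued exponent x
(zero unless x ∈ ℕ) -/
def dPow {A : Type*} [AddCommGroup A] [Module K A] (d : A → A) (x : K) (a : A) : A :=
  if h : ∃ j : ℕ, (j : K) = x then ((h.choose.factorial : K))⁻¹ • d^[h.choose] a else 0

/-- ∂_z^{(e_1)} ∂_z̄^{(e_2)} in the first variable pair -/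
def ddPow2 (e : Idx K) (c : Dist2 K M) : Dist2 K M :=
  dPow K (d1z K M) e.1 (dPow K (d1zb K M) e.2 c)

/-- the diagonal map c(𝐳,𝐰) ↦ c(𝐰,𝐰) -/
def diag (c : Dist2 K M) : Dist1 K M :=
  fun n => ∑ᶠ m : Idx K, c m (n.1 - m.1 - 1, n.2 - m.2 - 1)

/-- multiplication by (𝐳−𝐰)^h (expansion in z>w), on coefficients;
first index is 𝐳, second is 𝐰 -/
def zwPow (h : Idx K) (c : Dist2 K M) : Dist2 K M :=
  fun m k => ∑ᶠ i : ℕ × ℕ,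
    ((-1 : K) ^ (i.1 + i.2) * gchoose K h.1 i.1 * gchoose K h.2 i.2) •
      c (m.1 + h.1 - i.1, m.2 + h.2 - i.2) (k.1 + i.1, k.2 + i.2)

/-- multiplication by ((𝐳−𝐰)_{w>z})^h = (−1)^h (𝐰−𝐳)^h (expansion in w>z) -/
def zwPowW (h : Idx K) (c : Dist2 K M) : Dist2 K M :=
  fun m k => ∑ᶠ i : ℕ × ℕ,
    (negOnePow K (h.1 - h.2) * (-1 : K) ^ (i.1 + i.2) *
        gchoose K h.1 i.1 * gchoose K h.2 i.2) •
      c (m.1 + i.1, m.2 + i.2) (k.1 + h.1 - i.1, k.2 + h.2 - i.2)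

/-- multiplication by (𝐱+𝐰)^N of a distribution d(𝐰,𝐱) (first index 𝐰, second 𝐱);
the result is indexed by (x-index, w-index) -/
def xwPow (N : Idx K) (d : Dist2 K M) : Dist2 K M :=
  fun m k => ∑ᶠ i : ℕ × ℕ, (gchoose K N.1 i.1 * gchoose K N.2 i.2) •
    d (k.1 + i.1, k.2 + i.2) (m.1 + N.1 - i.1, m.2 + N.2 - i.2)

/-- multiplication by (𝐰+𝐱)^N of a distribution d(𝐰,𝐱) (first index 𝐰, second 𝐱);
the result is indexed by (x-index, w-index) -/
def wxPow (N : Idx K) (d : Dist2 K M) : Dist2 K M :=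
  fun m k => ∑ᶠ i : ℕ × ℕ, (gchoose K N.1 i.1 * gchoose K N.2 i.2) •
    d (k.1 + N.1 - i.1, k.2 + N.2 - i.2) (m.1 + i.1, m.2 + i.2)

/-- multiplication by 𝐱^A 𝐰^B (𝐱+𝐰)^N of p(𝐰,𝐱); result indexed (x-index, w-index) -/
def tripleXW (A B N : Idx K) (p : Dist2 K M) : Dist2 K M :=
  fun m k => ∑ᶠ l : ℕ × ℕ, (gchoose K N.1 l.1 * gchoose K N.2 l.2) •
    p (k.1 + B.1 + l.1, k.2 + B.2 + l.2) (m.1 + A.1 + N.1 - l.1, m.2 + A.2 + N.2 - l.2)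

/-- multiplication by 𝐱^A 𝐰^B (𝐰+𝐱)^N of p(𝐰,𝐱); result indexed (x-index, w-index) -/
def tripleWX (A B N : Idx K) (p : Dist2 K M) : Dist2 K M :=
  fun m k => ∑ᶠ l : ℕ × ℕ, (gchoose K N.1 l.1 * gchoose K N.2 l.2) •
    p (k.1 + B.1 + N.1 - l.1, k.2 + B.2 + N.2 - l.2) (m.1 + A.1 + l.1, m.2 + A.2 + l.2)

variable (E : Type*) [AddCommGroup E] [Module K E]

/-- End(E)-valued distributions in one variable pair -/
abbrev EDist1 := Dist1 K (Module.End K E)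

/-- End(E)-valued distributions in two variable pairs -/
abbrev EDist2 := Dist2 K (Module.End K E)

/-- End(E)-valued distributions in r variable pairs -/
abbrev EDistN (r : ℕ) := DistN K (Module.End K E) r

def ev1 (a : EDist1 K E) (v : E) : Dist1 K E := fun n => a n v

def ev2 (c : EDist2 K E) (v : E) : Dist2 K E := fun n k => c n k v

def evN {r : ℕ} (c : EDistN K E r) (v : E) : DistN K E r := fun n => c n v

/-- a(𝐳) is a field -/
def IsFieldD (a : EDist1 K E) : Prop := ∀ v, InLat1 K E (ev1 K E a v)

/-- a field in two variable pairs -/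
def IsField2D (c : EDist2 K E) : Prop := ∀ v, InLat2 K E (ev2 K E c v)

/-- the Koszul sign (−1)^{pq} -/
def koszul (p q : ZMod 2) : K := if p = 1 ∧ q = 1 then (-1 : K) else 1

/-- the data (c^i, 𝐡_i) is an OPE of the homogeneous distributions a(𝐳), b(𝐳)
of parities pa, pb (all identities to be read applied to each vector of E) -/
def IsOPE (pa pb : ZMod 2) (a b : EDist1 K E) {r : ℕ}
    (c : Fin r → EDist2 K E) (h : Fin r → Idx K) : Prop :=
  (∀ i, Kbar K (h i)) ∧ (∀ i, IsField2D K E (c i)) ∧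
  (∀ v m k, a m (b k v) = ∑ i, zwPow K E (-(h i)) (ev2 K E (c i) v) m k) ∧
  (∀ v m k, koszul K pa pb • (b k (a m v)) =
      ∑ i, zwPowW K E (-(h i)) (ev2 K E (c i) v) m k)

/-- a(𝐳), b(𝐳) (homogeneous of parities pa, pb) are local -/
def IsLocal (pa pb : ZMod 2) (a b : EDist1 K E) : Prop :=
  ∃ (r : ℕ) (c : Fin r → EDist2 K E) (h : Fin r → Idx K), IsOPE K E pa pb a b c h

/-- the exponents of an OPE are reduced: 𝐡_i ∉ 𝐡_j + ℤ² for i ≠ j -/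
def ReducedExp {r : ℕ} (h : Fin r → Idx K) : Prop :=
  ∀ i j, i ≠ j → ¬ IsIntPair K (h i - h j)

/-- the product field a(𝐰)_{(𝐧)}b(𝐰) built from an OPE (c,h), applied to a vector v -/
def prodAt {r : ℕ} (c : Fin r → EDist2 K E) (h : Fin r → Idx K) (n : Idx K)
    (v : E) : Dist1 K E :=
  fun m => ∑ i, diag K E
    (ddPow2 K E ((h i).1 - 1 - n.1, (h i).2 - 1 - n.2) (ev2 K E (c i) v)) m

/-- s₁ : a(𝐳) ↦ a_{(−1,−1)}1 -/
def s1 (one : E) (a : EDist1 K E) : E := a ((-1 : K), (-1 : K)) one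

/-- the distribution d (to be thought of as a(𝐳)1) equals
Σ_{𝐢∈ℕ²} T^{(i)} T̄^{(ī)} (d_{(−1,−1)}) 𝐳^𝐢, i.e. a(𝐳) is creative -/
def CreativeD (T Tb : Module.End K E) (d : Dist1 K E) : Prop :=
  (∀ i : ℕ × ℕ, d (-(i.1 : K) - 1, -(i.2 : K) - 1) =
      ((i.1.factorial : K)⁻¹ * (i.2.factorial : K)⁻¹) •
        ((T ^ i.1) * (Tb ^ i.2)) (d ((-1 : K), (-1 : K)))) ∧
  (∀ n : Idx K, (¬ ∃ i : ℕ × ℕ, n = (-(i.1 : K) - 1, -(i.2 : K) - 1)) → d n = 0)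

/-- a(𝐳) is translation covariant for (T, T̄) -/
def TransCov (T Tb : Module.End K E) (a : EDist1 K E) : Prop :=
  (∀ n : Idx K, T * a n - a n * T = (-n.1) • a (n.1 - 1, n.2)) ∧
  (∀ n : Idx K, Tb * a n - a n * Tb = (-n.2) • a (n.1, n.2 - 1))

/-- translation covariance of a product field, per vector -/
def TransCovAt (T Tb : Module.End K E) (P : E → Dist1 K E) : Prop :=
  (∀ v (m : Idx K), T (P v m) - P (T v) m = (-m.1) • P v (m.1 - 1, m.2)) ∧
  (∀ v (m : Idx K), Tb (P v m) - P (Tb v) m = (-m.2) • P v (m.1, m.2 - 1))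

/-- the identity field 1(z) = id_E -/
def idField : EDist1 K E :=
  fun n => if n = ((-1 : K), (-1 : K)) then (1 : Module.End K E) else 0

/-- pairs i < j in [r] -/
abbrev Pairs (r : ℕ) := {p : Fin r × Fin r // p.1 < p.2}

/-- the index shift of the i-th variable produced by the monomial of a binomial
expansion of ((𝐳_{p₁} − 𝐳_{p₂})_σ)^h belonging to 𝐤 ∈ ℕ² -/
def pairShift {r : ℕ} (p : Pairs r) (h : Idx K) (flip : Bool) (kk : ℕ × ℕ)
    (i : Fin r) : Idx K :=
  if i = p.1.1 then
    (if flip then ((kk.1 : K), (kk.2 : K)) else (h.1 - kk.1, h.2 - kk.2))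
  else if i = p.1.2 then
    (if flip then (h.1 - kk.1, h.2 - kk.2) else ((kk.1 : K), (kk.2 : K)))
  else 0

/-- the coefficient of a binomial expansion of ((𝐳_{p₁} − 𝐳_{p₂})_σ)^h
belonging to 𝐤 ∈ ℕ² -/
def pairCoef (h : Idx K) (flip : Bool) (kk : ℕ × ℕ) : K :=
  (if flip then negOnePow K (h.1 - h.2) else 1) * (-1 : K) ^ (kk.1 + kk.2) *
    gchoose K h.1 kk.1 * gchoose K h.2 kk.2

def flipOf {r : ℕ} (σ : Equiv.Perm (Fin r)) (p : Pairs r) : Bool :=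
  decide (σ.symm p.1.2 < σ.symm p.1.1)

/-- multiplication by Π_{i<j} ((𝐳_i − 𝐳_j)_σ)^{h_{ij}} on an r-variable distribution -/
def permMul {r : ℕ} (σ : Equiv.Perm (Fin r)) (hs : Pairs r → Idx K)
    (c : DistN K M r) : DistN K M r :=
  fun m => ∑ᶠ κ : Pairs r → ℕ × ℕ,
    (∏ p : Pairs r, pairCoef K (hs p) (flipOf σ p) (κ p)) •
      c (fun i => m i + ∑ p : Pairs r, pairShift K p (hs p) (flipOf σ p) (κ p) i)

/-- the Koszul sign ζ' produced by reordering a¹,…,aʳ into a^{σ1},…,a^{σr} -/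
def koszulPerm {r : ℕ} (ps : Fin r → ZMod 2) (σ : Equiv.Perm (Fin r)) : K :=
  ∏ p : Pairs r,
    if σ.symm p.1.2 < σ.symm p.1.1 ∧ ps p.1.1 = 1 ∧ ps p.1.2 = 1 then (-1 : K) else 1

/-- the composition a^{σ1}(𝐳_{σ1})_{m_{σ1}} ∘ ⋯ ∘ a^{σr}(𝐳_{σr})_{m_{σr}} applied to v -/
def compSeq {r : ℕ} (a : Fin r → EDist1 K E) (σ : Equiv.Perm (Fin r))
    (m : Fin r → Idx K) (v : E) : E :=
  (List.ofFn fun j : Fin r => σ j).foldr (fun i acc => a i (m i) acc) v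

/-- the data (c^α, 𝐡_{ij}^k) is a (multiple) OPE of the homogeneous distributions
a¹(𝐳),…,aʳ(𝐳) of parities ps -/
def IsMultOPE {r : ℕ} (a : Fin r → EDist1 K E) (ps : Fin r → ZMod 2)
    (rij : Fin r → Fin r → ℕ) (hs : ∀ i j : Fin r, Fin (rij i j) → Idx K)
    (c : ((p : Pairs r) → Fin (rij p.1.1 p.1.2)) → EDistN K E r) : Prop :=
  (∀ i j k, Kbar K (hs i j k)) ∧
  (∀ α v, InLatN K E (evN K E (c α) v)) ∧
  (∀ σ : Equiv.Perm (Fin r), ∀ v m,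
    koszulPerm K ps σ • compSeq K E a σ m v =
      ∑ α : (p : Pairs r) → Fin (rij p.1.1 p.1.2),
        permMul K E σ (fun p => -(hs p.1.1 p.1.2 (α p))) (evN K E (c α) v) m)

/-- a¹(𝐳),…,aʳ(𝐳) are multiply local -/
def MultiplyLocal {r : ℕ} (a : Fin r → EDist1 K E) (ps : Fin r → ZMod 2) : Prop :=
  ∃ (rij : Fin r → Fin r → ℕ) (hs : ∀ i j : Fin r, Fin (rij i j) → Idx K)
    (c : ((p : Pairs r) → Fin (rij p.1.1 p.1.2)) → EDistN K E r),
      IsMultOPE K E a ps rij hs c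

/-- a set of homogeneous fields (with parities pF) is multiply local -/
def MultLocalSet (F : Set (EDist1 K E)) (pF : EDist1 K E → ZMod 2) : Prop :=
  ∀ (r : ℕ) (f : Fin r → EDist1 K E), (∀ i, f i ∈ F) →
    MultiplyLocal K E f (fun i => pF (f i))

/-- a set of homogeneous fields (with parities pF) is uniformly local -/
def UnifLocalSet (F : Set (EDist1 K E)) (pF : EDist1 K E → ZMod 2) (one : E) : Prop :=
  ∃ (rr : EDist1 K E → EDist1 K E → ℕ)
    (hh : ∀ d e : EDist1 K E, Fin (rr d e) → Idx K),
    ∀ (r : ℕ) (f : Fin r → EDist1 K E), (∀ i, f i ∈ F) →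
      ∃ c, IsMultOPE K E f (fun i => pF (f i)) (fun i j => rr (f i) (f j))
          (fun i j => hh (f i) (f j)) c ∧
        ∀ α, IsPowN K E (evN K E (c α) one)

/-- a ∈ V is homogeneous of parity p w.r.t. the grading (ev, od) -/
def memPar {V : Type*} [AddCommGroup V] [Module K V] (ev od : Submodule K V)
    (a : V) (p : ZMod 2) : Prop :=
  (p = 0 ∧ a ∈ ev) ∨ (p = 1 ∧ a ∈ od)

/-- an endomorphism is homogeneous of parity p w.r.t. the grading (ev, od) -/
def EndPar {V : Type*} [AddCommGroup V] [Module K V] (ev od : Submodule K V)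
    (f : Module.End K V) (p : ZMod 2) : Prop :=
  if p = 0 then (∀ v ∈ ev, f v ∈ ev) ∧ (∀ v ∈ od, f v ∈ od)
  else (∀ v ∈ ev, f v ∈ od) ∧ (∀ v ∈ od, f v ∈ ev)

/-- a distribution is homogeneous of parity p -/
def EDistPar {V : Type*} [AddCommGroup V] [Module K V] (ev od : Submodule K V)
    (a : EDist1 K V) (p : ZMod 2) : Prop :=
  ∀ n, EndPar K ev od (a n) p

end OPEA

namespace OPEA

/-- an OPE-algebra -/
structure OPEAlg (K : Type*) [Field K] [CharZero K]
    (V : Type*) [AddCommGroup V] [Module K V] where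
  ev : Submodule K V
  od : Submodule K V
  compl : IsCompl ev od
  Y : V →ₗ[K] EDist1 K V
  Y_par : ∀ a p, memPar K ev od a p → ∀ (n : Idx K) b q, memPar K ev od b q →
    memPar K ev od (Y a n b) (p + q)
  one : V
  one_ev : one ∈ ev
  T : Module.End K V
  Tb : Module.End K V
  T_ev : EndPar K ev od T 0
  Tb_ev : EndPar K ev od Tb 0
  commTTb : T * Tb = Tb * T
  T_one : T one = 0
  Tb_one : Tb one = 0
  wcre : ∀ a, IsPow1 K V (ev1 K V (Y a) one)
  rid : ∀ a, Y a ((-1 : K), (-1 : K)) one = a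
  tcov : ∀ a, TransCov K V T Tb (Y a)
  loc : ∀ a b pa pb, memPar K ev od a pa → memPar K ev od b pb →
    IsLocal K V pa pb (Y a) (Y b)

/-- a bounded 𝕂̄-fold algebra -/
structure BFold (K : Type*) [Field K] [CharZero K]
    (V : Type*) [AddCommGroup V] [Module K V] where
  ev : Submodule K V
  od : Submodule K V
  compl : IsCompl ev od
  Y : V →ₗ[K] EDist1 K V
  Y_par : ∀ a p, memPar K ev od a p → ∀ (n : Idx K) b q, memPar K ev od b q →
    memPar K ev od (Y a n b) (p + q)
  fields : ∀ a, IsFieldD K V (Y a)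
  bounded : ∀ a (n : Idx K), ¬ Kbar K n → ∀ b, Y a n b = 0

/-- a bounded 𝕂̄-fold module over a bounded 𝕂̄-fold algebra -/
structure BMod (K : Type*) [Field K] [CharZero K]
    (V : Type*) [AddCommGroup V] [Module K V] (A : BFold K V)
    (Mo : Type*) [AddCommGroup Mo] [Module K Mo] where
  evM : Submodule K Mo
  odM : Submodule K Mo
  complM : IsCompl evM odM
  YM : V →ₗ[K] EDist1 K Mo
  YM_par : ∀ a p, memPar K A.ev A.od a p → ∀ n : Idx K, EndPar K evM odM (YM a n) p
  fieldsM : ∀ a, IsFieldD K Mo (YM a)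
  boundedM : ∀ a (n : Idx K), ¬ Kbar K n → ∀ c, YM a n c = 0

variable (K : Type*) [Field K] [CharZero K]
variable (V : Type*) [AddCommGroup V] [Module K V]
variable (Mo : Type*) [AddCommGroup Mo] [Module K Mo]

/-- the operator T₁ : a ↦ a_{(−2,−1)}1 of an OPE-algebra -/
def T1 (A : OPEAlg K V) : Module.End K V where
  toFun := fun a => A.Y a ((-2 : K), (-1 : K)) A.one
  map_add' := by
    intro x y
    simp [map_add, Pi.add_apply, LinearMap.add_apply]
  map_smul' := by
    intro c x
    simp [map_smul, Pi.smul_apply, LinearMap.smul_apply]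

/-- the operator T̄₁ : a ↦ a_{(−1,−2)}1 of an OPE-algebra -/
def T1b (A : OPEAlg K V) : Module.End K V where
  toFun := fun a => A.Y a ((-1 : K), (-2 : K)) A.one
  map_add' := by
    intro x y
    simp [map_add, Pi.add_apply, LinearMap.add_apply]
  map_smul' := by
    intro c x
    simp [map_smul, Pi.smul_apply, LinearMap.smul_apply]

/-- skew-symmetry for the pair (T, T̄) -/
def SkewSym (ev od : Submodule K V) (Yf : V → EDist1 K V)
    (T Tb : Module.End K V) : Prop :=
  ∀ a b pa pb, memPar K ev od a pa → memPar K ev od b pb →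
    ∀ n : Idx K, Kbar K n →
      (Function.support (fun i : ℕ × ℕ =>
        ((i.1.factorial : K)⁻¹ * (i.2.factorial : K)⁻¹ *
            negOnePow K (n.1 + i.1 - (n.2 + i.2))) •
          ((T ^ i.1) * (Tb ^ i.2)) (Yf a (n.1 + i.1, n.2 + i.2) b))).Finite ∧
      koszul K pa pb • Yf b n a =
        ∑ᶠ i : ℕ × ℕ, ((i.1.factorial : K)⁻¹ * (i.2.factorial : K)⁻¹ *
            negOnePow K (n.1 + i.1 - (n.2 + i.2))) •
          ((T ^ i.1) * (Tb ^ i.2)) (Yf a (n.1 + i.1, n.2 + i.2) b)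

/-- (T, T̄) is a translation endomorphism of the module with state-field map YM -/
def TransEnd (YM : V → EDist1 K Mo) (T Tb : Module.End K V) : Prop :=
  (∀ a (n : Idx K), YM (T a) n = (-n.1) • YM a (n.1 - 1, n.2)) ∧
  (∀ a (n : Idx K), YM (Tb a) n = (-n.2) • YM a (n.1, n.2 - 1))

/-- the coefficient at (x-index m, w-index k) of a(𝐱+𝐰) applied to the w-distribution bw -/
def lhsXW (YM : V → EDist1 K Mo) (a : V) (bw : Dist1 K Mo) (m k : Idx K) : Mo :=
  ∑ᶠ i : ℕ × ℕ, ((i.1.factorial : K)⁻¹ * (i.2.factorial : K)⁻¹) •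
    (((dz K (Module.End K Mo))^[i.1] ((dzb K (Module.End K Mo))^[i.2] (YM a))) m)
      (bw (k.1 + i.1, k.2 + i.2))

/-- a and cM are dual in the direct channel -/
def DualDirect (Y : V → EDist1 K V) (YM : V → EDist1 K Mo) (a : V) (cM : Mo) : Prop :=
  ∃ (s : ℕ) (d : Fin s → Idx K → Idx K → (V →ₗ[K] Mo)) (hj : Fin s → Idx K),
    (∀ j, Kbar K (hj j)) ∧
    (∀ j b, InLat2 K Mo (fun kw mx => d j kw mx b)) ∧
    (∀ b (m k : Idx K),
      lhsXW K V Mo YM a (fun k' => YM b k' cM) m k =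
        ∑ j, xwPow K Mo (-(hj j)) (fun kw mx => d j kw mx b) m k) ∧
    (∀ b (m k : Idx K),
      YM (Y a m b) k cM =
        ∑ j, wxPow K Mo (-(hj j)) (fun kw mx => d j kw mx b) m k)

/-- a and b are dual in the exchange channel on the module -/
def DualExch (Y : V → EDist1 K V) (YM : V → EDist1 K Mo) (a b : V) : Prop :=
  ∃ (r : ℕ) (hab : Fin r → Idx K), (∀ i, Kbar K (hab i)) ∧
    ∀ cM : Mo, ∃ (s : ℕ) (hac : Fin s → Idx K)
      (q : Fin r → Fin s → Idx K → Idx K → Mo),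
      (∀ j, Kbar K (hac j)) ∧
      (∀ i j kw mx, q i j kw mx ≠ 0 → IsNegInt K mx.1 ∧ IsNegInt K mx.2) ∧
      (∀ i j mx, InLat1 K Mo (fun kw => q i j kw mx)) ∧
      (∀ m k : Idx K,
        lhsXW K V Mo YM a (fun k' => YM b k' cM) m k =
          ∑ j, xwPow K Mo (-(hac j))
            (fun kw mx => ∑ i, q i j kw (mx.1 - (hab i).1, mx.2 - (hab i).2)) m k) ∧
      (∀ m k : Idx K,
        YM (Y a m b) k cM =
          ∑ j, wxPow K Mo (-(hac j))
            (fun kw mx => ∑ i, q i j kw (mx.1 - (hab i).1, mx.2 - (hab i).2)) m k)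

/-- the module with state-field map YM is dual -/
def IsDualMod (ev od : Submodule K V) (Y : V → EDist1 K V) (YM : V → EDist1 K Mo) : Prop :=
  ∃ (rVV : V → V → ℕ) (hVV : ∀ a b : V, Fin (rVV a b) → Idx K)
    (rVM : V → Mo → ℕ) (hVM : ∀ (a : V) (c : Mo), Fin (rVM a c) → Idx K),
    (∀ a b i, Kbar K (hVV a b i)) ∧ (∀ a c j, Kbar K (hVM a c j)) ∧
    ∀ a b pa pb, memPar K ev od a pa → memPar K ev od b pb → ∀ c : Mo,
      ∃ p : Fin (rVV a b) → Fin (rVM a c) → Fin (rVM b c) → Dist2 K Mo,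
        (∀ i j k, IsPow2 K Mo (p i j k)) ∧
        (∀ m k : Idx K,
          lhsXW K V Mo YM a (fun k' => YM b k' c) m k =
            ∑ i, ∑ j, ∑ kk, tripleXW K Mo (-(hVV a b i)) (-(hVM b c kk))
              (-(hVM a c j)) (p i j kk) m k) ∧
        (∀ m k : Idx K,
          YM (Y a m b) k c =
            ∑ i, ∑ j, ∑ kk, tripleWX K Mo (-(hVV a b i)) (-(hVM b c kk))
              (-(hVM a c j)) (p i j kk) m k)

/-- F_Y is multiply local -/
def MultLocalAlg (A : OPEAlg K V) : Prop :=
  ∀ (r : ℕ) (f : Fin r → V) (pf : Fin r → ZMod 2),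
    (∀ i, memPar K A.ev A.od (f i) (pf i)) →
      MultiplyLocal K V (fun i => A.Y (f i)) pf

/-- F_Y is uniformly local -/
def UnifLocalAlg (A : OPEAlg K V) : Prop :=
  ∃ (rr : V → V → ℕ) (hh : ∀ a b : V, Fin (rr a b) → Idx K),
    ∀ (r : ℕ) (f : Fin r → V) (pf : Fin r → ZMod 2),
      (∀ i, memPar K A.ev A.od (f i) (pf i)) →
        ∃ c, IsMultOPE K V (fun i => A.Y (f i)) pf (fun i j => rr (f i) (f j))
            (fun i j => hh (f i) (f j)) c ∧
          ∀ α, IsPowN K V (evN K V (c α) A.one)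

end OPEA
namespace OPEA

section Binomial

variable {K : Type*} [Field K]

theorem gchoose_zero (x : K) : gchoose K x 0 = 1 := by
  simp [gchoose]

theorem succ_mul_gchoose_succ [CharZero K] (x : K) (k : ℕ) :
    ((k : K) + 1) * gchoose K x (k + 1) = (x - k) * gchoose K x k := by
  have h1 : (k.factorial : K) ≠ 0 := by exact_mod_cast k.factorial_ne_zero
  have h2 : (k : K) + 1 ≠ 0 := by exact_mod_cast k.succ_ne_zero
  simp only [gchoose, Finset.prod_range_succ, Nat.factorial_succ]
  push_cast
  field_simp

theorem succ_mul_gchoose_succ' [CharZero K] (x : K) (k : ℕ) :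
    ((k : K) + 1) * gchoose K x (k + 1) = x * gchoose K (x - 1) k := by
  have h1 : (k.factorial : K) ≠ 0 := by exact_mod_cast k.factorial_ne_zero
  have h2 : (k : K) + 1 ≠ 0 := by exact_mod_cast k.succ_ne_zero
  have h3 : ∏ i ∈ Finset.range k, (x - ((i + 1 : ℕ) : K)) =
      ∏ i ∈ Finset.range k, (x - 1 - (i : K)) :=
    Finset.prod_congr rfl fun i _ => by push_cast; ring
  simp only [gchoose, Finset.prod_range_succ', Nat.factorial_succ, h3]
  push_cast
  field_simp
  ring

/-- upper negation -/
theorem neg_one_pow_mul_gchoose_neg [CharZero K] (x : K) (k : ℕ) :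
    (-1) ^ k * gchoose K (-x) k = gchoose K (x + k - 1) k := by
  induction k with
  | zero => simp [gchoose_zero]
  | succ k ih =>
    have h2 : (k : K) + 1 ≠ 0 := by exact_mod_cast k.succ_ne_zero
    apply mul_left_cancel₀ h2
    have e1 := succ_mul_gchoose_succ (-x) k
    have e2 := succ_mul_gchoose_succ' (x + (k + 1 : ℕ) - 1) k
    have e3 : x + ((k + 1 : ℕ) : K) - 1 - 1 = x + k - 1 := by push_cast; ring
    rw [e2, e3, ← ih, pow_succ]
    push_cast
    linear_combination (-(-1) ^ k) * e1

/-- the binomial coefficient with K-valued lower argument `e`, zero unless `e ∈ ℕ` -/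
def binom (x e : K) : K :=
  if h : ∃ j : ℕ, (j : K) = e then gchoose K x h.choose else 0

theorem binom_natCast [CharZero K] (x : K) (j : ℕ) : binom x (j : K) = gchoose K x j := by
  have h : ∃ i : ℕ, (i : K) = j := ⟨j, rfl⟩
  rw [binom, dif_pos h, Nat.cast_injective h.choose_spec]

theorem binom_of_not {x e : K} (h : ¬ ∃ j : ℕ, (j : K) = e) : binom x e = 0 := dif_neg h

theorem neg_one_ne_natCast [CharZero K] : ¬ ∃ j : ℕ, (j : K) = -1 := by
  rintro ⟨j, hj⟩
  have h2 : (j : K) + 1 ≠ 0 := by exact_mod_cast j.succ_ne_zero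
  exact h2 (by rw [hj]; ring)

theorem not_natCast_sub_one {e : K} (h : ¬ ∃ j : ℕ, (j : K) = e) :
    ¬ ∃ j : ℕ, (j : K) = e - 1 := by
  rintro ⟨j, hj⟩
  exact h ⟨j + 1, by push_cast; rw [hj]; ring⟩

/-- absorption -/
theorem mul_binom [CharZero K] (x e : K) : e * binom x e = x * binom (x - 1) (e - 1) := by
  by_cases h : ∃ j : ℕ, (j : K) = e
  · obtain ⟨j, rfl⟩ := h
    cases j with
    | zero => simp [binom_of_not neg_one_ne_natCast]
    | succ k =>
      have : ((k + 1 : ℕ) : K) - 1 = (k : ℕ) := by push_cast; ring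
      rw [this, binom_natCast, binom_natCast, ← succ_mul_gchoose_succ']
      push_cast; ring
  · simp [binom_of_not h, binom_of_not (not_natCast_sub_one h)]

/-- Pascal's rule -/
theorem binom_add_one [CharZero K] (x e : K) : binom (x + 1) e = binom x e + binom x (e - 1) := by
  by_cases h : ∃ j : ℕ, (j : K) = e
  · obtain ⟨j, rfl⟩ := h
    cases j with
    | zero =>
      have h1 (y : K) : binom y 0 = 1 := by
        simpa [gchoose_zero] using binom_natCast y 0
      simp [h1, binom_of_not (x := x) neg_one_ne_natCast]
    | succ k =>
      have h2 : (k : K) + 1 ≠ 0 := by exact_mod_cast k.succ_ne_zero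
      have : ((k + 1 : ℕ) : K) - 1 = (k : ℕ) := by push_cast; ring
      rw [this, binom_natCast, binom_natCast, binom_natCast]
      apply mul_left_cancel₀ h2
      have e1 := succ_mul_gchoose_succ' (x + 1) k
      have e2 := succ_mul_gchoose_succ x k
      rw [add_sub_cancel_right] at e1
      linear_combination e1 - e2
  · simp [binom_of_not h, binom_of_not (not_natCast_sub_one h)]

theorem sub_mul_binom [CharZero K] (x e : K) : (x - e) * binom x e = x * binom (x - 1) e := by
  have h1 := binom_add_one (x - 1) e
  rw [sub_add_cancel] at h1
  linear_combination x * h1 - mul_binom x e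

/-- up to sign, the coefficient of degree `δ` in the binomial expansion of exponent `-h` -/
def expCoef (h δ : K) : K := binom (h + δ - 1) δ

theorem expCoef_of_not {h δ : K} (hδ : ¬ ∃ j : ℕ, (j : K) = δ) : expCoef h δ = 0 :=
  binom_of_not hδ

theorem exists_common_top {Q : Type*} (s : Finset Q) (l : Q → K) :
    ∃ (ρ : Q → K) (d : Q → ℕ), (∀ q ∈ s, l q = ρ q - d q) ∧
      ∀ q q', IsInt K (ρ q - ρ q') → ρ q = ρ q' := by
  let mk : K → K ⧸ AddSubgroup.zmultiples (1 : K) := QuotientAddGroup.mk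
  have hr : ∀ x : K, ∃ z : ℤ, x = (mk x).out + z := by
    intro x
    have h1 : mk ((mk x).out) = mk x := Quotient.out_eq' _
    obtain ⟨z, hz⟩ := AddSubgroup.mem_zmultiples_iff.mp (QuotientAddGroup.eq.mp h1)
    exact ⟨z, by rw [zsmul_one] at hz; rw [hz]; ring⟩
  choose z hz using hr
  let N : ℕ := ∑ q ∈ s, (z (l q)).natAbs
  refine ⟨fun q => (mk (l q)).out + N, fun q => ((N : ℤ) - z (l q)).toNat, fun q hq => ?_,
    fun q q' ⟨k, hk⟩ => ?_⟩
  · have h1 : (z (l q)).natAbs ≤ N :=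
      Finset.single_le_sum (f := fun q => (z (l q)).natAbs) (fun _ _ => Nat.zero_le _) hq
    have h2 : ((((N : ℤ) - z (l q)).toNat : ℤ)) = (N : ℤ) - z (l q) :=
      Int.toNat_of_nonneg (by omega)
    have h3 : ((((N : ℤ) - z (l q)).toNat : ℕ) : K) = (N : K) - z (l q) := by
      have := congrArg (Int.cast : ℤ → K) h2
      push_cast at this
      exact this
    rw [h3]
    linear_combination hz (l q)
  · have h1 : mk (l q) = mk (l q') := by
      refine QuotientAddGroup.eq.mpr (AddSubgroup.mem_zmultiples_iff.mpr
        ⟨z (l q') - z (l q) - k, ?_⟩)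
      rw [zsmul_one]
      push_cast
      linear_combination hz (l q) - hz (l q') - hk
    simp only [h1]

end Binomial

section Separation

variable {K : Type*} [Field K] [CharZero K] {M : Type*} [AddCommGroup M] [Module K M]
  {Q : Type*}

/-- the functions `x ↦ C(x, J)` separate the values of `x` -/
theorem sum_fiber_eq_zero (s : Finset Q) (x : Q → K) (g : Q → M)
    (H : ∀ J : ℕ, ∑ q ∈ s, gchoose K (x q) J • g q = 0) (x₀ : K) :
    ∑ q ∈ s with x q = x₀, g q = 0 := by
  have key : ∀ (Λ : Finset K) (J : ℕ),
      ∑ q ∈ s, ((∏ y ∈ Λ, (x q - y)) * gchoose K (x q) J) • g q = 0 := by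
    intro Λ
    induction Λ using Finset.induction_on with
    | empty => simpa using H
    | insert y Λ hy ih =>
      intro J
      have e : ∀ q ∈ s, ((∏ u ∈ insert y Λ, (x q - u)) * gchoose K (x q) J) • g q =
          ((J : K) + 1) • ((∏ u ∈ Λ, (x q - u)) * gchoose K (x q) (J + 1)) • g q +
          ((J : K) - y) • ((∏ u ∈ Λ, (x q - u)) * gchoose K (x q) J) • g q := by
        intro q _
        rw [Finset.prod_insert hy, smul_smul, smul_smul, ← add_smul]
        congr 1
        linear_combination (-∏ u ∈ Λ, (x q - u)) * succ_mul_gchoose_succ (x q) J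
      rw [Finset.sum_congr rfl e, Finset.sum_add_distrib, ← Finset.smul_sum, ← Finset.smul_sum,
        ih, ih, smul_zero, smul_zero, add_zero]
  set Λ := (s.image x).erase x₀ with hΛ
  have h0 := key Λ 0
  simp only [gchoose_zero, mul_one] at h0
  have h1 : ∑ q ∈ s, (∏ y ∈ Λ, (x q - y)) • g q =
      (∏ y ∈ Λ, (x₀ - y)) • ∑ q ∈ s with x q = x₀, g q := by
    rw [Finset.smul_sum, Finset.sum_filter]
    refine Finset.sum_congr rfl fun q hq => ?_
    split_ifs with hx
    · rw [hx]
    · rw [Finset.prod_eq_zero (i := x q), zero_smul]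
      · simp only [hΛ, Finset.mem_erase, Finset.mem_image]
        exact ⟨hx, q, hq, rfl⟩
      · exact sub_self _
  rw [h1] at h0
  refine (smul_eq_zero.mp h0).resolve_left ?_
  refine Finset.prod_ne_zero_iff.mpr fun y hy => ?_
  exact sub_ne_zero.mpr (Finset.ne_of_mem_erase hy).symm

theorem expCoef_natCast (h : K) (j : ℕ) : expCoef h (j : K) = (-1) ^ j * gchoose K (-h) j := by
  rw [expCoef, binom_natCast, neg_one_pow_mul_gchoose_neg]

/-- the relation satisfied by all evaluations of `(z - w)^{-h} w^{-l-1}` in fixed total degree -/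
def PascalRel (P : K → K → K) : Prop := ∀ h l, P h (l - 1) = P h l - P (h - 1) l

theorem pascalRel_expCoef (L : K) : PascalRel fun h l => expCoef h (l - L) := by
  intro h l
  have := binom_add_one (h + (l - L) - 2) (l - L)
  have e1 : h + (l - L) - 2 + 1 = h + (l - L) - 1 := by ring
  have e2 : h + (l - 1 - L) - 1 = h + (l - L) - 2 := by ring
  have e3 : h - 1 + (l - L) - 1 = h + (l - L) - 2 := by ring
  have e4 : l - 1 - L = l - L - 1 := by ring
  simp only [expCoef]
  rw [e2, e3, e4, ← e1, this]
  ring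

theorem pascalRel_binom (T n : K) : PascalRel fun h l => binom (l - T + h - 1) (h - 1 - n) := by
  intro h l
  have := binom_add_one (l - T + h - 2) (h - 1 - n)
  have e1 : l - T + h - 2 + 1 = l - T + h - 1 := by ring
  have e2 : l - 1 - T + h - 1 = l - T + h - 2 := by ring
  have e3 : l - T + (h - 1) - 1 = l - T + h - 2 := by ring
  have e4 : h - 1 - 1 - n = h - 1 - n - 1 := by ring
  simp only
  rw [e2, e3, e4, ← e1, this]
  ring

theorem exists_pascal_expansion (d : ℕ) :
    ∃ w : ℕ →₀ K, ∀ P : K → K → K, PascalRel P →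
    ∀ h l, P h (l - d) = ∑ s ∈ w.support, w s * P (h - s) l := by
  induction d with
  | zero => exact ⟨Finsupp.single 0 1, fun P _ h l => by
      change _ = (Finsupp.single 0 (1 : K)).sum fun s y => y * P (h - (s : ℕ)) l
      rw [Finsupp.sum_single_index] <;> simp⟩
  | succ d ih =>
    obtain ⟨w, hw⟩ := ih
    refine ⟨w - w.mapDomain Nat.succ, fun P hP h l => ?_⟩
    change _ = (w - w.mapDomain Nat.succ).sum fun s y => y * P (h - s) l
    rw [Finsupp.sum_sub_index (fun _ _ _ => sub_mul _ _ _),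
      Finsupp.sum_mapDomain_index (fun _ => zero_mul _) (fun _ _ _ => add_mul _ _ _)]
    have e : l - ((d + 1 : ℕ) : K) = l - d - 1 := by push_cast; ring
    rw [e, hP, hw P hP, hw P hP]
    congr 1
    refine Finset.sum_congr rfl fun s _ => ?_
    push_cast
    congr 2
    ring

theorem sum_smul_eq_zero_of_separated (s : Finset Q) (h l : Q → K) (g : Q → M)
    (hl : ∀ q ∈ s, ∀ q' ∈ s, IsInt K (l q - l q') → l q = l q')
    (H : ∀ L, ∑ q ∈ s, expCoef (h q) (l q - L) • g q = 0) (P : K → K → K) :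
    ∑ q ∈ s, P (h q) (l q) • g q = 0 := by
  have key : ∀ q₀ ∈ s, ∑ q ∈ s with (h q, l q) = (h q₀, l q₀), g q = 0 := by
    intro q₀ hq₀
    have h1 : ∀ J : ℕ, ∑ q ∈ s with l q = l q₀, gchoose K (-(h q)) J • g q = 0 := by
      intro J
      have h2 := congrArg (fun y => ((-1 : K) ^ J) • y) (H (l q₀ - J))
      simp only [smul_zero, Finset.smul_sum] at h2
      rw [← h2, Finset.sum_filter]
      refine Finset.sum_congr rfl fun q hq => ?_
      split_ifs with hx
      · have e : l q - (l q₀ - J) = (J : K) := by rw [hx]; ring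
        rw [e, expCoef_natCast, smul_smul, ← mul_assoc, ← pow_add, ← two_mul,
          pow_mul, neg_one_sq, one_pow, one_mul]
      · rw [expCoef_of_not, zero_smul, smul_zero]
        rintro ⟨j, hj⟩
        refine hx (hl q hq q₀ hq₀ ⟨(j : ℤ) - J, ?_⟩)
        push_cast
        linear_combination hj
    have h3 := sum_fiber_eq_zero _ _ g h1 (-(h q₀))
    rw [Finset.filter_filter] at h3
    rw [← h3]
    refine Finset.sum_congr (Finset.filter_congr fun q _ => ?_) fun _ _ => rfl
    rw [Prod.mk.injEq, neg_inj, and_comm]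
  rw [← Finset.sum_fiberwise_of_maps_to (t := s.image fun q => (h q, l q))
    (g := fun q => (h q, l q)) (fun q hq => Finset.mem_image_of_mem _ hq)]
  refine Finset.sum_eq_zero fun p hp => ?_
  obtain ⟨q₀, hq₀, rfl⟩ := Finset.mem_image.mp hp
  rw [Finset.sum_congr rfl (g := fun q => P (h q₀) (l q₀) • g q), ← Finset.smul_sum,
    key q₀ hq₀, smul_zero]
  intro q hq
  have := (Finset.mem_filter.mp hq).2
  rw [Prod.mk.injEq] at this
  rw [this.1, this.2]

theorem sum_smul_eq_zero_of_pascalRel (s : Finset Q) (h l : Q → K) (g : Q → M)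
    (H : ∀ L, ∑ q ∈ s, expCoef (h q) (l q - L) • g q = 0)
    (P : K → K → K) (hP : PascalRel P) :
    ∑ q ∈ s, P (h q) (l q) • g q = 0 := by
  obtain ⟨ρ, d, hd, hρ⟩ := exists_common_top s l
  choose w hw using exists_pascal_expansion (K := K)
  have tr : ∀ R : K → K → K, PascalRel R → ∑ q ∈ s, R (h q) (l q) • g q =
      ∑ p ∈ s.sigma fun q => (w (d q)).support,
        R (h p.1 - p.2) (ρ p.1) • w (d p.1) p.2 • g p.1 := by
    intro R hR
    rw [Finset.sum_sigma]
    refine Finset.sum_congr rfl fun q hq => ?_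
    rw [hd q hq, hw (d q) R hR, Finset.sum_smul]
    exact Finset.sum_congr rfl fun j _ => by rw [smul_smul, mul_comm]
  rw [tr P hP]
  refine sum_smul_eq_zero_of_separated _ (fun p : Σ _ : Q, ℕ => h p.1 - p.2) (fun p => ρ p.1)
    (fun p => w (d p.1) p.2 • g p.1) (fun p _ p' _ => hρ _ _) (fun L => ?_) P
  rw [← tr _ (pascalRel_expCoef L)]
  exact H L

theorem sum_smul_eq_zero_of_pascalRel₂ (s : Finset Q) (h l : Q → Idx K) (g : Q → M)
    (H : ∀ L : Idx K, ∑ q ∈ s, (expCoef (h q).1 ((l q).1 - L.1) *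
      expCoef (h q).2 ((l q).2 - L.2)) • g q = 0)
    (P R : K → K → K) (hP : PascalRel P) (hR : PascalRel R) :
    ∑ q ∈ s, (P (h q).1 (l q).1 * R (h q).2 (l q).2) • g q = 0 := by
  simp only [mul_smul]
  refine sum_smul_eq_zero_of_pascalRel s (fun q => (h q).1) (fun q => (l q).1) _
    (fun L₁ => ?_) P hP
  simp only [smul_comm (expCoef _ _) (R _ _)]
  refine sum_smul_eq_zero_of_pascalRel s (fun q => (h q).2) (fun q => (l q).2) _
    (fun L₂ => ?_) R hR
  rw [← H (L₁, L₂)]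
  exact Finset.sum_congr rfl fun q _ => by rw [smul_smul, mul_comm]

end Separation

section Expansion

variable {K : Type*} [Field K] [CharZero K] {M : Type*} [AddCommGroup M] [Module K M]

theorem finite_setOf_isNegInt (p q t : K) :
    {x : K | IsNegInt K (x - p) ∧ IsNegInt K (t - x - q)}.Finite := by
  rcases Set.eq_empty_or_nonempty {x : K | IsNegInt K (x - p) ∧ IsNegInt K (t - x - q)} with
    h | ⟨x₀, ⟨a₀, ha₀, hx₀⟩, ⟨b₀, hb₀, hy₀⟩⟩
  · rw [h]; exact Set.finite_empty
  · refine ((Set.finite_Icc (a₀ + b₀) 0).image fun a : ℤ => p + (a : K)).subset ?_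
    rintro x ⟨⟨a, ha, hx⟩, ⟨b, hb, hy⟩⟩
    have h1 : a + b = a₀ + b₀ := by
      have : ((a + b : ℤ) : K) = ((a₀ + b₀ : ℤ) : K) := by
        push_cast
        linear_combination hx + hy - hx₀ - hy₀
      exact_mod_cast this
    exact ⟨a, ⟨by omega, by omega⟩, by simp only [hx]; ring⟩

/-- a distribution in `M⌊𝐳,𝐰⌋` is finite in each total degree -/
theorem InLat2.finite_support {M : Type*} [AddCommGroup M] {c : Dist2 K M} (hc : InLat2 K M c)
    (T : Idx K) :
    {l : Idx K | c (T.1 - l.1, T.2 - l.2) l ≠ 0}.Finite := by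
  obtain ⟨S, hS⟩ := hc
  refine (S.finite_toSet.biUnion fun m _ =>
    (finite_setOf_isNegInt m.2.1 m.1.1 T.1).prod (finite_setOf_isNegInt m.2.2 m.1.2 T.2)).subset ?_
  intro l hl
  obtain ⟨m, hm, ⟨h1, h2⟩, h3, h4⟩ := hS _ _ hl
  exact Set.mem_biUnion hm ⟨⟨h3, h1⟩, h4, h2⟩

theorem InLat2.finite_support_smul {c : Dist2 K M} (hc : InLat2 K M c) (T : Idx K)
    (f : Idx K → K) : (Function.support fun l : Idx K =>
      f l • c (T.1 - l.1, T.2 - l.2) l).Finite :=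
  (hc.finite_support T).subset fun _ hl h0 => hl (by simp only [h0, smul_zero])

theorem zwPow_neg_eq (h : Idx K) (c : Dist2 K M) (m k : Idx K) :
    zwPow K M (-h) c m k = ∑ᶠ l : Idx K,
      (expCoef h.1 (l.1 - k.1) * expCoef h.2 (l.2 - k.2)) •
        c (m.1 + k.1 - h.1 - l.1, m.2 + k.2 - h.2 - l.2) l := by
  set F : Idx K → M := fun l => (expCoef h.1 (l.1 - k.1) * expCoef h.2 (l.2 - k.2)) •
        c (m.1 + k.1 - h.1 - l.1, m.2 + k.2 - h.2 - l.2) l with hF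
  let φ : ℕ × ℕ → Idx K := fun i => (k.1 + i.1, k.2 + i.2)
  have hφ : Function.Injective φ := by
    intro i j hij
    simp only [φ, Prod.mk.injEq, add_right_inj, Nat.cast_inj] at hij
    exact Prod.ext hij.1 hij.2
  have hsupp : Function.support F ⊆ Set.range φ := by
    intro l hl
    have h0 : expCoef h.1 (l.1 - k.1) * expCoef h.2 (l.2 - k.2) ≠ 0 := by
      intro h0; exact hl (by simp only [hF, h0, zero_smul])
    have h1 : ∃ j : ℕ, (j : K) = l.1 - k.1 := by
      by_contra hn; exact h0 (by rw [expCoef_of_not hn, zero_mul])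
    have h2 : ∃ j : ℕ, (j : K) = l.2 - k.2 := by
      by_contra hn; exact h0 (by rw [expCoef_of_not hn, mul_zero])
    obtain ⟨i, hi⟩ := h1
    obtain ⟨j, hj⟩ := h2
    exact ⟨(i, j), Prod.ext (by simp only [φ, hi]; ring) (by simp only [φ, hj]; ring)⟩
  rw [← finsum_mem_univ F, finsum_mem_inter_support_eq F Set.univ (Set.range φ)
    (by rw [Set.univ_inter, Set.inter_eq_right.mpr hsupp]), finsum_mem_range hφ]
  refine finsum_congr fun i => ?_
  have e1 : k.1 + (i.1 : K) - k.1 = i.1 := by ring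
  have e2 : k.2 + (i.2 : K) - k.2 = i.2 := by ring
  have e3 : m.1 + k.1 - h.1 - (k.1 + (i.1 : K)) = m.1 + (-h).1 - i.1 := by
    rw [Prod.fst_neg]; ring
  have e4 : m.2 + k.2 - h.2 - (k.2 + (i.2 : K)) = m.2 + (-h).2 - i.2 := by
    rw [Prod.snd_neg]; ring
  simp only [hF, φ]
  rw [e1, e2, e3, e4, expCoef_natCast, expCoef_natCast, Prod.fst_neg, Prod.snd_neg]
  congr 1
  ring

theorem iterate_d1z (j : ℕ) (c : Dist2 K M) (n k : Idx K) :
    (d1z K M)^[j] c n k =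
      ((-1) ^ j * ∏ i ∈ Finset.range j, (n.1 - (i : K))) • c (n.1 - j, n.2) k := by
  induction j generalizing n with
  | zero => simp
  | succ j ih =>
    rw [Function.iterate_succ_apply']
    simp only [d1z]
    rw [ih, smul_smul, Finset.prod_range_succ']
    have e : ∏ i ∈ Finset.range j, (n.1 - ((i + 1 : ℕ) : K)) =
        ∏ i ∈ Finset.range j, (n.1 - 1 - (i : K)) :=
      Finset.prod_congr rfl fun i _ => by push_cast; ring
    rw [e]
    congr 1
    · push_cast; ring
    · congr 2; push_cast; ring

theorem iterate_d1zb (j : ℕ) (c : Dist2 K M) (n k : Idx K) :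
    (d1zb K M)^[j] c n k =
      ((-1) ^ j * ∏ i ∈ Finset.range j, (n.2 - (i : K))) • c (n.1, n.2 - j) k := by
  induction j generalizing n with
  | zero => simp
  | succ j ih =>
    rw [Function.iterate_succ_apply']
    simp only [d1zb]
    rw [ih, smul_smul, Finset.prod_range_succ']
    have e : ∏ i ∈ Finset.range j, (n.2 - ((i + 1 : ℕ) : K)) =
        ∏ i ∈ Finset.range j, (n.2 - 1 - (i : K)) :=
      Finset.prod_congr rfl fun i _ => by push_cast; ring
    rw [e]
    congr 1
    · push_cast; ring
    · congr 2; push_cast; ring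

theorem inv_factorial_mul_prod (x : K) (j : ℕ) :
    ((j.factorial : K))⁻¹ * ((-1) ^ j * ∏ i ∈ Finset.range j, (x - (i : K))) =
      binom (j - x - 1) j := by
  have h := neg_one_pow_mul_gchoose_neg (-x) j
  rw [neg_neg] at h
  have e : (j : K) - x - 1 = -x + j - 1 := by ring
  rw [binom_natCast, e, ← h, gchoose]
  ring

theorem dPow_d1z (e : K) (c : Dist2 K M) (n k : Idx K) :
    dPow K (d1z K M) e c n k = binom (e - n.1 - 1) e • c (n.1 - e, n.2) k := by
  by_cases h : ∃ j : ℕ, (j : K) = e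
  · rw [dPow, dif_pos h]
    change ((h.choose.factorial : K))⁻¹ • ((d1z K M)^[h.choose] c n k) = _
    rw [iterate_d1z, smul_smul, inv_factorial_mul_prod, h.choose_spec]
  · rw [dPow, dif_neg h, binom_of_not h, zero_smul]; rfl

theorem dPow_d1zb (e : K) (c : Dist2 K M) (n k : Idx K) :
    dPow K (d1zb K M) e c n k = binom (e - n.2 - 1) e • c (n.1, n.2 - e) k := by
  by_cases h : ∃ j : ℕ, (j : K) = e
  · rw [dPow, dif_pos h]
    change ((h.choose.factorial : K))⁻¹ • ((d1zb K M)^[h.choose] c n k) = _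
    rw [iterate_d1zb, smul_smul, inv_factorial_mul_prod, h.choose_spec]
  · rw [dPow, dif_neg h, binom_of_not h, zero_smul]; rfl

/-- `(∂_z^{(h-1-n)} ∂_z̄^{(h̄-1-n̄)} c)|_{𝐳=𝐰}` -/
def diagTerm (c : Dist2 K M) (h n : Idx K) : Dist1 K M :=
  diag K M (ddPow2 K M (h.1 - 1 - n.1, h.2 - 1 - n.2) c)

theorem diagTerm_eq (c : Dist2 K M) (h n m : Idx K) :
    diagTerm c h n m = ∑ᶠ l : Idx K,
      (binom (l.1 - (m.1 + n.1) + h.1 - 1) (h.1 - 1 - n.1) *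
        binom (l.2 - (m.2 + n.2) + h.2 - 1) (h.2 - 1 - n.2)) •
        c (m.1 + n.1 - h.1 - l.1, m.2 + n.2 - h.2 - l.2) l := by
  let φ : Idx K → Idx K := fun k => (m.1 - k.1 - 1, m.2 - k.2 - 1)
  have hφ : Function.Bijective φ := by
    refine Function.Involutive.bijective fun k => ?_
    refine Prod.ext ?_ ?_ <;> simp only [φ] <;> ring
  refine finsum_eq_of_bijective φ hφ fun k => ?_
  rw [ddPow2, dPow_d1z, dPow_d1zb, smul_smul]
  simp only [φ]
  have e1 : m.1 - k.1 - 1 - (m.1 + n.1) + h.1 - 1 = h.1 - 1 - n.1 - k.1 - 1 := by ring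
  have e2 : m.2 - k.2 - 1 - (m.2 + n.2) + h.2 - 1 = h.2 - 1 - n.2 - k.2 - 1 := by ring
  have e3 : m.1 + n.1 - h.1 - (m.1 - k.1 - 1) = k.1 - (h.1 - 1 - n.1) := by ring
  have e4 : m.2 + n.2 - h.2 - (m.2 - k.2 - 1) = k.2 - (h.2 - 1 - n.2) := by ring
  rw [e1, e2, e3, e4]

/-- linear relations between binomial expansions pass to the diagonal terms -/
theorem sum_smul_diagTerm_eq_zero {ι : Type*} [Fintype ι] (α : ι → K) (c : ι → Dist2 K M)
    (h : ι → Idx K) (hc : ∀ i, InLat2 K M (c i))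
    (H : ∀ m k, ∑ i, α i • zwPow K M (-(h i)) (c i) m k = 0) (n m : Idx K) :
    ∑ i, α i • diagTerm (c i) (h i) n m = 0 := by
  let X : ι → Idx K := fun i => (m.1 + n.1 - (h i).1, m.2 + n.2 - (h i).2)
  let S : ι → Finset (Idx K) := fun i => ((hc i).finite_support (X i)).toFinset
  let g : (Σ _ : ι, Idx K) → M := fun q =>
    α q.1 • c q.1 ((X q.1).1 - q.2.1, (X q.1).2 - q.2.2) q.2
  have tr : ∀ (i : ι) (f : Idx K → K),
      α i • ∑ᶠ l : Idx K, f l • c i ((X i).1 - l.1, (X i).2 - l.2) l =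
        ∑ l ∈ S i, f l • g ⟨i, l⟩ := by
    intro i f
    rw [finsum_eq_sum_of_support_subset (s := S i), Finset.smul_sum]
    · exact Finset.sum_congr rfl fun l _ => smul_comm _ _ _
    · intro l hl
      simp only [S, Set.Finite.coe_toFinset, Set.mem_ofPred_eq]
      intro h0
      exact hl (by simp only [h0, smul_zero])
  have key := sum_smul_eq_zero_of_pascalRel₂ (Finset.univ.sigma S) (fun q => h q.1)
    (fun q => q.2) g (fun L => ?_) _ _ (pascalRel_binom (m.1 + n.1) n.1)
    (pascalRel_binom (m.2 + n.2) n.2)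
  · rw [← key, Finset.sum_sigma]
    refine Finset.sum_congr rfl fun i _ => ?_
    rw [diagTerm_eq]
    exact tr i _
  · rw [← H (m.1 + n.1 - L.1, m.2 + n.2 - L.2) L, Finset.sum_sigma]
    refine Finset.sum_congr rfl fun i _ => ?_
    rw [zwPow_neg_eq, ← tr i]
    simp only [X, sub_add_cancel]

end Expansion

section Derivatives

variable {K : Type*} [Field K] {M : Type*} [AddCommGroup M] [Module K M]

/-- `∂` in the second variable pair of a two-variable distribution (`w`-component) -/
def d2z (c : Dist2 K M) : Dist2 K M := fun n k => (-k.1) • c n (k.1 - 1, k.2)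

theorem InLat2.d1z {c : Dist2 K M} (hc : InLat2 K M c) : InLat2 K M (d1z K M c) := by
  obtain ⟨S, hS⟩ := hc
  refine ⟨S.image fun m => ((m.1.1 + 1, m.1.2), m.2), fun n k hn => ?_⟩
  obtain ⟨m, hm, ⟨h1, h2⟩, h3⟩ := hS (n.1 - 1, n.2) k fun h0 => hn (by
    simp only [OPEA.d1z, h0, smul_zero])
  refine ⟨_, Finset.mem_image_of_mem _ hm, ⟨?_, h2⟩, h3⟩
  have e : n.1 - (m.1.1 + 1) = n.1 - 1 - m.1.1 := by ring
  simpa only [e] using h1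

theorem InLat2.swap {M : Type*} [AddCommGroup M] {c : Dist2 K M} (hc : InLat2 K M c) :
    InLat2 K M (Function.swap c) := by
  obtain ⟨S, hS⟩ := hc
  refine ⟨S.image Prod.swap, fun n k hn => ?_⟩
  obtain ⟨m, hm, h1, h2⟩ := hS k n hn
  exact ⟨_, Finset.mem_image_of_mem _ hm, h2, h1⟩

theorem InLat2.d2z {c : Dist2 K M} (hc : InLat2 K M c) : InLat2 K M (d2z c) :=
  hc.swap.d1z.swap

theorem InLat2.smul {c : Dist2 K M} (hc : InLat2 K M c) (x : K) : InLat2 K M (x • c) := by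
  obtain ⟨S, hS⟩ := hc
  exact ⟨S, fun n k hn => hS n k fun h0 => hn (by simp only [Pi.smul_apply, h0, smul_zero])⟩

theorem zwPow_smul (h : Idx K) (x : K) (c : Dist2 K M) (m k : Idx K) :
    zwPow K M h (x • c) m k = x • zwPow K M h c m k := by
  simp only [zwPow, smul_finsum, Pi.smul_apply]
  exact finsum_congr fun i => smul_comm _ _ _

theorem zwPowW_eq (h : Idx K) (c : Dist2 K M) (m k : Idx K) :
    zwPowW K M h c m k = negOnePow K (h.1 - h.2) • zwPow K M h (Function.swap c) k m := by
  simp only [zwPow, zwPowW, smul_finsum, Function.swap]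
  exact finsum_congr fun i => by rw [smul_smul]; congr 1; ring

theorem zwPowW_smul (h : Idx K) (x : K) (c : Dist2 K M) (m k : Idx K) :
    zwPowW K M h (x • c) m k = x • zwPowW K M h c m k := by
  rw [zwPowW_eq, zwPowW_eq, smul_comm x]
  exact congrArg _ (zwPow_smul h x (Function.swap c) k m)

theorem finsum_shift {N : Type*} [AddCommGroup N] (F : Idx K → N) :
    ∑ᶠ l : Idx K, F l = ∑ᶠ l : Idx K, F (l.1 + 1, l.2) := by
  refine (finsum_comp_equiv ((Equiv.addRight (1 : K)).prodCongr (Equiv.refl K))).symm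

variable [CharZero K]

theorem negOnePow_intCast (k : ℤ) : negOnePow K (k : K) = (-1) ^ k := by
  have h : ∃ i : ℤ, (i : K) = k := ⟨k, rfl⟩
  rw [negOnePow, dif_pos h, Int.cast_injective h.choose_spec]

theorem negOnePow_sub_one {x : K} (hx : IsInt K x) : negOnePow K (x - 1) = -negOnePow K x := by
  obtain ⟨k, rfl⟩ := hx
  have e : (k : K) - 1 = ((k - 1 : ℤ) : K) := by push_cast; ring
  rw [e, negOnePow_intCast, negOnePow_intCast, zpow_sub_one₀ (by simp)]
  norm_num

theorem negOnePow_neg {x : K} (hx : IsInt K x) : negOnePow K (-x) = negOnePow K x := by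
  obtain ⟨k, rfl⟩ := hx
  have e : -(k : K) = ((-k : ℤ) : K) := by push_cast; ring
  rw [e, negOnePow_intCast, negOnePow_intCast, zpow_neg, ← inv_zpow]
  norm_num

theorem zwPow_neg_d1z (h : Idx K) {c : Dist2 K M} (hc : InLat2 K M c) (m k : Idx K) :
    (-m.1) • zwPow K M (-h) c (m.1 - 1, m.2) k =
      zwPow K M (-h) (d1z K M c) m k - h.1 • zwPow K M (-(h.1 + 1, h.2)) c m k := by
  rw [sub_eq_add_neg _ (h.1 • _), ← neg_smul, zwPow_neg_eq, zwPow_neg_eq, zwPow_neg_eq,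
    smul_finsum, smul_finsum]
  let X : Idx K := (m.1 + k.1 - (h.1 + 1), m.2 + k.2 - h.2)
  have t : ∀ l : Idx K, c (m.1 + k.1 - h.1 - l.1 - 1, m.2 + k.2 - h.2 - l.2) l =
      c (X.1 - l.1, X.2 - l.2) l := fun l => by congr 2; simp only [X]; ring
  have t' : ∀ l : Idx K, c (m.1 - 1 + k.1 - h.1 - l.1, m.2 + k.2 - h.2 - l.2) l =
      c (X.1 - l.1, X.2 - l.2) l := fun l => by congr 2; simp only [X]; ring
  simp only [d1z, t, t', smul_smul]
  rw [← finsum_add_distrib (hc.finite_support_smul X _) (hc.finite_support_smul X _)]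
  refine finsum_congr fun l => ?_
  rw [← add_smul]
  congr 1
  have e := sub_mul_binom (h.1 + (l.1 - k.1)) (l.1 - k.1)
  have e1 : h.1 + 1 + (l.1 - k.1) - 1 = h.1 + (l.1 - k.1) := by ring
  simp only [expCoef]
  rw [e1]
  linear_combination binom (h.2 + (l.2 - k.2) - 1) (l.2 - k.2) * e

theorem zwPow_neg_d2z (h : Idx K) {c : Dist2 K M} (hc : InLat2 K M c) (m k : Idx K) :
    (-k.1) • zwPow K M (-h) c m (k.1 - 1, k.2) =
      zwPow K M (-h) (d2z c) m k + h.1 • zwPow K M (-(h.1 + 1, h.2)) c m k := by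
  rw [zwPow_neg_eq, zwPow_neg_eq, zwPow_neg_eq, smul_finsum, smul_finsum,
    finsum_shift (fun l => _ • d2z c _ l)]
  let X : Idx K := (m.1 + k.1 - (h.1 + 1), m.2 + k.2 - h.2)
  have t : ∀ l : Idx K, c (m.1 + k.1 - h.1 - (l.1 + 1), m.2 + k.2 - h.2 - l.2) l =
      c (X.1 - l.1, X.2 - l.2) l := fun l => by congr 2; simp only [X]; ring
  have t' : ∀ l : Idx K, c (m.1 + (k.1 - 1) - h.1 - l.1, m.2 + k.2 - h.2 - l.2) l =
      c (X.1 - l.1, X.2 - l.2) l := fun l => by congr 2; simp only [X]; ring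
  simp only [d2z, add_sub_cancel_right, t, t', smul_smul]
  rw [← finsum_add_distrib (hc.finite_support_smul X _) (hc.finite_support_smul X _)]
  refine finsum_congr fun l => ?_
  rw [← add_smul]
  congr 1
  have e := sub_mul_binom (h.1 + (l.1 - k.1)) (l.1 - k.1)
  have e' := mul_binom (h.1 + (l.1 - k.1)) (l.1 + 1 - k.1)
  have e1 : h.1 + 1 + (l.1 - k.1) - 1 = h.1 + (l.1 - k.1) := by ring
  have e2 : h.1 + (l.1 + 1 - k.1) - 1 = h.1 + (l.1 - k.1) := by ring
  have e3 : l.1 + 1 - k.1 - 1 = l.1 - k.1 := by ring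
  have e4 : l.1 - (k.1 - 1) = l.1 + 1 - k.1 := by ring
  simp only [expCoef, e4]
  rw [e1, e2]
  rw [e3] at e'
  linear_combination binom (h.2 + (l.2 - k.2) - 1) (l.2 - k.2) * (e' - e)

theorem zwPowW_neg_d1z {h : Idx K} (hh : Kbar K h) {c : Dist2 K M} (hc : InLat2 K M c)
    (m k : Idx K) :
    (-m.1) • zwPowW K M (-h) c (m.1 - 1, m.2) k =
      zwPowW K M (-h) (d1z K M c) m k - h.1 • zwPowW K M (-(h.1 + 1, h.2)) c m k := by
  have e := zwPow_neg_d2z h hc.swap k m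
  have s : negOnePow K ((-(h.1 + 1, h.2) : Idx K).1 - (-(h.1 + 1, h.2) : Idx K).2) =
      -negOnePow K ((-h).1 - (-h).2) := by
    rw [← negOnePow_sub_one]
    · congr 1; simp only [Prod.fst_neg, Prod.snd_neg]; ring
    · obtain ⟨z, hz⟩ := hh
      exact ⟨-z, by push_cast; rw [hz]; simp only [Prod.fst_neg, Prod.snd_neg]; ring⟩
  rw [zwPowW_eq, zwPowW_eq, zwPowW_eq, s, smul_comm, e, neg_smul, smul_neg, sub_neg_eq_add,
    smul_add, smul_comm h.1]
  rfl

theorem zwPowW_neg_d2z {h : Idx K} (hh : Kbar K h) {c : Dist2 K M} (hc : InLat2 K M c)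
    (m k : Idx K) :
    (-k.1) • zwPowW K M (-h) c m (k.1 - 1, k.2) =
      zwPowW K M (-h) (d2z c) m k + h.1 • zwPowW K M (-(h.1 + 1, h.2)) c m k := by
  have e := zwPow_neg_d1z h hc.swap k m
  have s : negOnePow K ((-(h.1 + 1, h.2) : Idx K).1 - (-(h.1 + 1, h.2) : Idx K).2) =
      -negOnePow K ((-h).1 - (-h).2) := by
    rw [← negOnePow_sub_one]
    · congr 1; simp only [Prod.fst_neg, Prod.snd_neg]; ring
    · obtain ⟨z, hz⟩ := hh
      exact ⟨-z, by push_cast; rw [hz]; simp only [Prod.fst_neg, Prod.snd_neg]; ring⟩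
  rw [zwPowW_eq, zwPowW_eq, zwPowW_eq, s, smul_comm, e, neg_smul, smul_neg, ← sub_eq_add_neg,
    smul_sub, smul_comm h.1]
  rfl

theorem diagTerm_d1z (h n : Idx K) {c : Dist2 K M} (hc : InLat2 K M c) (m : Idx K) :
    diagTerm (d1z K M c) h n m - h.1 • diagTerm c (h.1 + 1, h.2) n m =
      (-n.1) • diagTerm c h (n.1 - 1, n.2) m := by
  rw [sub_eq_add_neg _ (h.1 • _), ← neg_smul, diagTerm_eq, diagTerm_eq, diagTerm_eq,
    smul_finsum, smul_finsum]
  let X : Idx K := (m.1 + n.1 - (h.1 + 1), m.2 + n.2 - h.2)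
  have t : ∀ l : Idx K, c (m.1 + n.1 - h.1 - l.1 - 1, m.2 + n.2 - h.2 - l.2) l =
      c (X.1 - l.1, X.2 - l.2) l := fun l => by congr 2; simp only [X]; ring
  have t' : ∀ l : Idx K, c (m.1 + (n.1 - 1) - h.1 - l.1, m.2 + n.2 - h.2 - l.2) l =
      c (X.1 - l.1, X.2 - l.2) l := fun l => by congr 2; simp only [X]; ring
  simp only [d1z, t, t', smul_smul]
  rw [← finsum_add_distrib (hc.finite_support_smul X _) (hc.finite_support_smul X _)]
  refine finsum_congr fun l => ?_
  rw [← add_smul]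
  congr 1
  have e := mul_binom (l.1 - (m.1 + n.1) + h.1) (h.1 - n.1)
  have e1 : l.1 - (m.1 + n.1) + (h.1 + 1) - 1 = l.1 - (m.1 + n.1) + h.1 := by ring
  have e2 : h.1 + 1 - 1 - n.1 = h.1 - n.1 := by ring
  have e3 : l.1 - (m.1 + (n.1 - 1)) + h.1 - 1 = l.1 - (m.1 + n.1) + h.1 := by ring
  have e4 : h.1 - 1 - (n.1 - 1) = h.1 - n.1 := by ring
  have e5 : h.1 - 1 - n.1 = h.1 - n.1 - 1 := by ring
  rw [e1, e2, e3, e4, e5]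
  linear_combination (-binom (l.2 - (m.2 + n.2) + h.2 - 1) (h.2 - 1 - n.2)) * e

theorem diagTerm_d1z_add_d2z (h n : Idx K) {c : Dist2 K M} (hc : InLat2 K M c) (m : Idx K) :
    diagTerm (d1z K M c) h n m + diagTerm (d2z c) h n m =
      (-m.1) • diagTerm c h n (m.1 - 1, m.2) := by
  rw [diagTerm_eq, diagTerm_eq, diagTerm_eq, smul_finsum, finsum_shift (fun l => _ • d2z c _ l)]
  let X : Idx K := (m.1 + n.1 - (h.1 + 1), m.2 + n.2 - h.2)
  have t : ∀ l : Idx K, c (m.1 + n.1 - h.1 - l.1 - 1, m.2 + n.2 - h.2 - l.2) l =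
      c (X.1 - l.1, X.2 - l.2) l := fun l => by congr 2; simp only [X]; ring
  have t' : ∀ l : Idx K, c (m.1 + n.1 - h.1 - (l.1 + 1), m.2 + n.2 - h.2 - l.2) l =
      c (X.1 - l.1, X.2 - l.2) l := fun l => by congr 2; simp only [X]; ring
  have t'' : ∀ l : Idx K, c (m.1 - 1 + n.1 - h.1 - l.1, m.2 + n.2 - h.2 - l.2) l =
      c (X.1 - l.1, X.2 - l.2) l := fun l => by congr 2; simp only [X]; ring
  simp only [d1z, d2z, add_sub_cancel_right, t, t', t'', smul_smul]
  rw [← finsum_add_distrib (hc.finite_support_smul X _) (hc.finite_support_smul X _)]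
  refine finsum_congr fun l => ?_
  rw [← add_smul]
  congr 1
  have e := sub_mul_binom (l.1 - (m.1 + n.1) + h.1) (h.1 - 1 - n.1)
  have e1 : l.1 + 1 - (m.1 + n.1) + h.1 - 1 = l.1 - (m.1 + n.1) + h.1 := by ring
  have e2 : l.1 - (m.1 - 1 + n.1) + h.1 - 1 = l.1 - (m.1 + n.1) + h.1 := by ring
  rw [e1, e2]
  linear_combination (-binom (l.2 - (m.2 + n.2) + h.2 - 1) (h.2 - 1 - n.2)) * e

end Derivatives

section Conjugation

variable {K : Type*} [Field K] {M : Type*} [AddCommGroup M]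

/-- interchange of `z` and `z̄` in one variable pair -/
def conj1 (a : Dist1 K M) : Dist1 K M := fun n => a n.swap

/-- interchange of `z` and `z̄` in both variable pairs -/
def conj2 (c : Dist2 K M) : Dist2 K M := fun n k => c n.swap k.swap

theorem InLat2.conj2 {c : Dist2 K M} (hc : InLat2 K M c) : InLat2 K M (conj2 c) := by
  obtain ⟨S, hS⟩ := hc
  refine ⟨S.image fun m => (m.1.swap, m.2.swap), fun n k hn => ?_⟩
  obtain ⟨m, hm, h1, h2⟩ := hS _ _ hn
  exact ⟨_, Finset.mem_image_of_mem _ hm, h1.symm, h2.symm⟩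

theorem finsum_swap {α : Type*} (F : α × α → M) :
    ∑ᶠ l : α × α, F l = ∑ᶠ l : α × α, F l.swap :=
  (finsum_comp_equiv (Equiv.prodComm α α)).symm

variable [CharZero K] [Module K M]

theorem zwPow_conj2 (h : Idx K) (c : Dist2 K M) (m k : Idx K) :
    zwPow K M (-h.swap) (conj2 c) m k = zwPow K M (-h) c m.swap k.swap := by
  rw [zwPow_neg_eq, zwPow_neg_eq, finsum_swap]
  exact finsum_congr fun l => by rw [mul_comm]; rfl

theorem zwPowW_conj2 {h : Idx K} (hh : Kbar K h) (c : Dist2 K M) (m k : Idx K) :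
    zwPowW K M (-h.swap) (conj2 c) m k = zwPowW K M (-h) c m.swap k.swap := by
  rw [zwPowW_eq, zwPowW_eq]
  have e : Function.swap (conj2 c) = conj2 (Function.swap c) := rfl
  rw [e, zwPow_conj2, ← negOnePow_neg]
  · congr 2
    simp only [Prod.fst_neg, Prod.snd_neg, Prod.fst_swap, Prod.snd_swap]
    ring
  · obtain ⟨z, hz⟩ := hh
    exact ⟨z, by
      rw [hz]; simp only [Prod.fst_neg, Prod.snd_neg, Prod.fst_swap, Prod.snd_swap]; ring⟩

theorem diagTerm_conj2 (c : Dist2 K M) (h n m : Idx K) :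
    diagTerm (conj2 c) h.swap n m = diagTerm c h n.swap m.swap := by
  rw [diagTerm_eq, diagTerm_eq, finsum_swap]
  exact finsum_congr fun l => by rw [mul_comm]; rfl

end Conjugation

section Products

variable {K : Type*} [Field K] {E : Type*} [AddCommGroup E] [Module K E]
  {pa pb : ZMod 2} {a b : EDist1 K E} {r : ℕ} {c : Fin r → EDist2 K E} {h : Fin r → Idx K}

theorem prodAt_eq (c : Fin r → EDist2 K E) (h : Fin r → Idx K) (n : Idx K) (v : E) (m : Idx K) :
    prodAt K E c h n v m = ∑ i, diagTerm (ev2 K E (c i) v) (h i) n m := rfl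

theorem kbar_add_one {h : Idx K} (hh : Kbar K h) : Kbar K (h.1 + 1, h.2) := by
  obtain ⟨z, hz⟩ := hh
  exact ⟨z + 1, by push_cast; rw [hz]; ring⟩

variable [CharZero K]

theorem IsOPE.conj (H : IsOPE K E pa pb a b c h) :
    IsOPE K E pa pb (conj1 a) (conj1 b) (fun i => conj2 (c i)) (fun i => (h i).swap) := by
  obtain ⟨h1, h2, h3, h4⟩ := H
  refine ⟨fun i => ?_, fun i v => (h2 i v).conj2, fun v m k => ?_, fun v m k => ?_⟩
  · obtain ⟨z, hz⟩ := h1 i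
    exact ⟨-z, by push_cast; rw [hz]; simp⟩
  · exact (h3 v m.swap k.swap).trans
      (Finset.sum_congr rfl fun i _ => (zwPow_conj2 (h i) (ev2 K E (c i) v) m k).symm)
  · exact (h4 v m.swap k.swap).trans
      (Finset.sum_congr rfl fun i _ => (zwPowW_conj2 (h1 i) (ev2 K E (c i) v) m k).symm)

theorem IsLocal.conj (H : IsLocal K E pa pb a b) : IsLocal K E pa pb (conj1 a) (conj1 b) := by
  obtain ⟨r, c, h, H⟩ := H
  exact ⟨r, _, _, H.conj⟩

theorem prodAt_conj (c : Fin r → EDist2 K E) (h : Fin r → Idx K) (n : Idx K) (v : E)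
    (m : Idx K) :
    prodAt K E (fun i => conj2 (c i)) (fun i => (h i).swap) n v m =
      prodAt K E c h n.swap v m.swap :=
  Finset.sum_congr rfl fun i _ => diagTerm_conj2 (ev2 K E (c i) v) (h i) n m

theorem IsOPE.apply_dz_left (H : IsOPE K E pa pb a b c h) (v : E) (m k : Idx K) :
    dz K _ a m (b k v) = ∑ i, (zwPow K E (-(h i)) (d1z K E (ev2 K E (c i) v)) m k -
      (h i).1 • zwPow K E (-((h i).1 + 1, (h i).2)) (ev2 K E (c i) v) m k) := by
  simp only [← zwPow_neg_d1z _ (H.2.1 _ v), ← Finset.smul_sum]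
  rw [← H.2.2.1]
  rfl

theorem IsOPE.apply_dz_right (H : IsOPE K E pa pb a b c h) (v : E) (m k : Idx K) :
    a m (dz K _ b k v) = ∑ i, (zwPow K E (-(h i)) (d2z (ev2 K E (c i) v)) m k +
      (h i).1 • zwPow K E (-((h i).1 + 1, (h i).2)) (ev2 K E (c i) v) m k) := by
  simp only [← zwPow_neg_d2z _ (H.2.1 _ v), ← Finset.smul_sum]
  rw [← H.2.2.1, ← map_smul]
  rfl

theorem IsOPE.isLocal_dz_left (H : IsOPE K E pa pb a b c h) :
    IsLocal K E pa pb (dz K _ a) b := by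
  refine ⟨r + r, Fin.append (fun i => d1z K _ (c i)) fun i => -(h i).1 • c i,
    Fin.append h fun i => ((h i).1 + 1, (h i).2), fun i => ?_, fun i v => ?_,
    fun v m k => ?_, fun v m k => ?_⟩
  · induction i using Fin.addCases with
    | left i => simpa only [Fin.append_left] using H.1 i
    | right i => simpa only [Fin.append_right] using kbar_add_one (H.1 i)
  · induction i using Fin.addCases with
    | left i => rw [Fin.append_left]; exact (H.2.1 i v).d1z
    | right i => rw [Fin.append_right]; exact (H.2.1 i v).smul (-(h i).1)
  · rw [H.apply_dz_left, Fin.sum_univ_add, ← Finset.sum_add_distrib]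
    refine Finset.sum_congr rfl fun i _ => ?_
    simp only [Fin.append_left, Fin.append_right]
    rw [sub_eq_add_neg, ← neg_smul, ← zwPow_smul]
    rfl
  · have e : koszul K pa pb • b k (dz K _ a m v) =
        (-m.1) • koszul K pa pb • b k (a (m.1 - 1, m.2) v) := by
      rw [smul_comm (-m.1), ← map_smul (b k) (-m.1)]; rfl
    rw [e, H.2.2.2, Fin.sum_univ_add, ← Finset.sum_add_distrib, Finset.smul_sum]
    refine Finset.sum_congr rfl fun i _ => ?_
    simp only [Fin.append_left, Fin.append_right]
    rw [zwPowW_neg_d1z (H.1 i) (H.2.1 i v), sub_eq_add_neg, ← neg_smul, ← zwPowW_smul]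
    rfl

theorem IsOPE.isLocal_dz_right (H : IsOPE K E pa pb a b c h) :
    IsLocal K E pa pb a (dz K _ b) := by
  refine ⟨r + r, Fin.append (fun i => d2z (c i)) fun i => (h i).1 • c i,
    Fin.append h fun i => ((h i).1 + 1, (h i).2), fun i => ?_, fun i v => ?_,
    fun v m k => ?_, fun v m k => ?_⟩
  · induction i using Fin.addCases with
    | left i => simpa only [Fin.append_left] using H.1 i
    | right i => simpa only [Fin.append_right] using kbar_add_one (H.1 i)
  · induction i using Fin.addCases with
    | left i => rw [Fin.append_left]; exact (H.2.1 i v).d2z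
    | right i => rw [Fin.append_right]; exact (H.2.1 i v).smul (h i).1
  · rw [H.apply_dz_right, Fin.sum_univ_add, ← Finset.sum_add_distrib]
    refine Finset.sum_congr rfl fun i _ => ?_
    simp only [Fin.append_left, Fin.append_right]
    rw [← zwPow_smul]
    rfl
  · have e : koszul K pa pb • dz K _ b k (a m v) =
        (-k.1) • koszul K pa pb • b (k.1 - 1, k.2) (a m v) := by
      rw [smul_comm (-k.1)]; rfl
    rw [e, H.2.2.2, Fin.sum_univ_add, ← Finset.sum_add_distrib, Finset.smul_sum]
    refine Finset.sum_congr rfl fun i _ => ?_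
    simp only [Fin.append_left, Fin.append_right]
    rw [zwPowW_neg_d2z (H.1 i) (H.2.1 i v), ← zwPowW_smul]
    rfl

theorem IsOPE.prodAt_dz_left (H : IsOPE K E pa pb a b c h)
    {r' : ℕ} {c' : Fin r' → EDist2 K E} {h' : Fin r' → Idx K}
    (H' : IsOPE K E pa pb (dz K _ a) b c' h') (n : Idx K) (v : E) (m : Idx K) :
    prodAt K E c' h' n v m = (-n.1) • prodAt K E c h (n.1 - 1, n.2) v m := by
  have key := sum_smul_diagTerm_eq_zero (ι := Fin r' ⊕ Fin r ⊕ Fin r)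
    (Sum.elim (fun _ => 1) (Sum.elim (fun _ => -1) fun i => (h i).1))
    (Sum.elim (fun i => ev2 K E (c' i) v)
      (Sum.elim (fun i => d1z K E (ev2 K E (c i) v)) fun i => ev2 K E (c i) v))
    (Sum.elim h' (Sum.elim h fun i => ((h i).1 + 1, (h i).2)))
    (by
      rintro (i | i | i)
      · exact H'.2.1 i v
      · exact (H.2.1 i v).d1z
      · exact H.2.1 i v)
    (fun m k => by
      simp only [Fintype.sum_sum_type, Sum.elim_inl, Sum.elim_inr, one_smul]
      rw [← H'.2.2.1, H.apply_dz_left, ← Finset.sum_add_distrib, ← Finset.sum_add_distrib]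
      exact Finset.sum_eq_zero fun i _ => by rw [neg_one_smul]; abel) n m
  simp only [Fintype.sum_sum_type, Sum.elim_inl, Sum.elim_inr, one_smul, neg_smul,
    Finset.sum_neg_distrib] at key
  rw [prodAt_eq, prodAt_eq, Finset.smul_sum]
  simp only [← diagTerm_d1z _ _ (H.2.1 _ v), Finset.sum_sub_distrib]
  rw [← sub_eq_zero, ← key]
  abel

theorem IsOPE.dz_prodAt (H : IsOPE K E pa pb a b c h)
    {r' r'' : ℕ} {c' : Fin r' → EDist2 K E} {h' : Fin r' → Idx K}
    {c'' : Fin r'' → EDist2 K E} {h'' : Fin r'' → Idx K}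
    (H' : IsOPE K E pa pb (dz K _ a) b c' h') (H'' : IsOPE K E pa pb a (dz K _ b) c'' h'')
    (n : Idx K) (v : E) (m : Idx K) :
    dz K E (prodAt K E c h n v) m = prodAt K E c' h' n v m + prodAt K E c'' h'' n v m := by
  have key := sum_smul_diagTerm_eq_zero (ι := (Fin r' ⊕ Fin r'') ⊕ Fin r ⊕ Fin r)
    (Sum.elim (fun _ => 1) (fun _ => -1))
    (Sum.elim (Sum.elim (fun i => ev2 K E (c' i) v) fun i => ev2 K E (c'' i) v)
      (Sum.elim (fun i => d1z K E (ev2 K E (c i) v)) fun i => d2z (ev2 K E (c i) v)))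
    (Sum.elim (Sum.elim h' h'') (Sum.elim h h))
    (by
      rintro ((i | i) | i | i)
      · exact H'.2.1 i v
      · exact H''.2.1 i v
      · exact (H.2.1 i v).d1z
      · exact (H.2.1 i v).d2z)
    (fun m k => by
      simp only [Fintype.sum_sum_type, Sum.elim_inl, Sum.elim_inr, one_smul]
      rw [← H'.2.2.1, ← H''.2.2.1, H.apply_dz_left, H.apply_dz_right,
        ← Finset.sum_add_distrib, ← Finset.sum_add_distrib, ← Finset.sum_add_distrib]
      exact Finset.sum_eq_zero fun i _ => by rw [neg_one_smul, neg_one_smul]; abel) n m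
  simp only [Fintype.sum_sum_type, Sum.elim_inl, Sum.elim_inr, one_smul, neg_smul,
    Finset.sum_neg_distrib] at key
  simp only [dz]
  rw [prodAt_eq, prodAt_eq, prodAt_eq, Finset.smul_sum]
  simp only [← diagTerm_d1z_add_d2z _ _ (H.2.1 _ v), Finset.sum_add_distrib]
  rw [eq_comm, ← sub_eq_zero, ← key]
  abel

end Products

/-- (∂_z, ∂_z̄) is a translation endomorphism and a translation
generator for the products of local distributions. -/
theorem stmt_1 (K : Type*) [Field K] [CharZero K]
    (E : Type*) [AddCommGroup E] [Module K E]
    (evE odE : Submodule K E) (hgr : IsCompl evE odE)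
    (a b : EDist1 K E) (pa pb : ZMod 2)
    (ha : EDistPar K evE odE a pa) (hb : EDistPar K evE odE b pb)
    {r : ℕ} (c : Fin r → EDist2 K E) (h : Fin r → Idx K)
    (hch : IsOPE K E pa pb a b c h) :
    IsLocal K E pa pb (dz K (Module.End K E) a) b ∧
    IsLocal K E pa pb (dzb K (Module.End K E) a) b ∧
    IsLocal K E pa pb a (dz K (Module.End K E) b) ∧
    IsLocal K E pa pb a (dzb K (Module.End K E) b) ∧
    (∀ {r' : ℕ} (c' : Fin r' → EDist2 K E) (h' : Fin r' → Idx K),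
      IsOPE K E pa pb (dz K (Module.End K E) a) b c' h' →
      ∀ (n : Idx K) (v : E) (m : Idx K),
        prodAt K E c' h' n v m = (-n.1) • prodAt K E c h (n.1 - 1, n.2) v m) ∧
    (∀ {r' : ℕ} (c' : Fin r' → EDist2 K E) (h' : Fin r' → Idx K),
      IsOPE K E pa pb (dzb K (Module.End K E) a) b c' h' →
      ∀ (n : Idx K) (v : E) (m : Idx K),
        prodAt K E c' h' n v m = (-n.2) • prodAt K E c h (n.1, n.2 - 1) v m) ∧
    (∀ {r' r'' : ℕ} (c' : Fin r' → EDist2 K E) (h' : Fin r' → Idx K)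
        (c'' : Fin r'' → EDist2 K E) (h'' : Fin r'' → Idx K),
      IsOPE K E pa pb (dz K (Module.End K E) a) b c' h' →
      IsOPE K E pa pb a (dz K (Module.End K E) b) c'' h'' →
      ∀ (n : Idx K) (v : E) (m : Idx K),
        dz K E (prodAt K E c h n v) m =
          prodAt K E c' h' n v m + prodAt K E c'' h'' n v m) ∧
    (∀ {r' r'' : ℕ} (c' : Fin r' → EDist2 K E) (h' : Fin r' → Idx K)
        (c'' : Fin r'' → EDist2 K E) (h'' : Fin r'' → Idx K),
      IsOPE K E pa pb (dzb K (Module.End K E) a) b c' h' →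
      IsOPE K E pa pb a (dzb K (Module.End K E) b) c'' h'' →
      ∀ (n : Idx K) (v : E) (m : Idx K),
        dzb K E (prodAt K E c h n v) m =
          prodAt K E c' h' n v m + prodAt K E c'' h'' n v m) := by
  refine ⟨hch.isLocal_dz_left, hch.conj.isLocal_dz_left.conj, hch.isLocal_dz_right,
    hch.conj.isLocal_dz_right.conj, fun c' h' H' => hch.prodAt_dz_left H', fun c' h' H' n v m => ?_,
    fun c' h' c'' h'' H' H'' => hch.dz_prodAt H' H'', fun c' h' c'' h'' H' H'' n v m => ?_⟩
  · have key := hch.conj.prodAt_dz_left H'.conj n.swap v m.swap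
    rwa [prodAt_conj, prodAt_conj] at key
  · have key := hch.conj.dz_prodAt H'.conj H''.conj n.swap v m.swap
    rw [prodAt_conj, prodAt_conj] at key
    rw [Prod.swap_swap, Prod.swap_swap] at key
    rw [← key]
    exact congrArg ((-m.2) • ·) (prodAt_conj c h n.swap v (m.2 - 1, m.1)).symm

end OPEA
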